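/- Let I ⊆ {1,…,n} and let m be a maximal ideal of D such that t_i ∈ m for every i ∈ I, and t_j ∉ τ(m) for every j ∈ {1,…,n}∖I and every τ ∈ G (i.e., m is a maximal break with respect to I). Then the left A_n(a)-module A_n(a)/J is simple, where J is the left ideal of A_n(a) generated by m together with the elements x_i, i ∈ I. -/

import Mathlib

/-!
STATEMENT 14: if m is a maximal ideal of D = ℂ[t₁,…,tₙ] which is a maximal break with
respect to I ⊆ {1,…,n} (tᵢ ∈ m for i ∈ I, and t_j ∉ τ(m) for j ∉ I and all τ ∈ G), then
A_n(a)/J is a simple left A_n(a)-module, where J is the left ideal generated by m together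
with the xᵢ, i ∈ I.  The Weyl algebra A_n(a) is constructed as a quotient of the free
algebra by the defining relations; D is identified with the polynomial algebra
MvPolynomial (Fin n) ℂ, with tᵢ = Xᵢ realized as ∂ᵢxᵢ in A_n(a); G is the subgroup of
algebra automorphisms of D generated by the shifts σᵢ : t_j ↦ t_j − δᵢⱼ·a.
-/

/-- Defining relations of the Weyl algebra `A_n(a)`: generators `inl i = xᵢ`, `inr i = ∂ᵢ`,
relations `xᵢxⱼ = xⱼxᵢ`, `∂ᵢ∂ⱼ = ∂ⱼ∂ᵢ`, `∂ᵢxⱼ = xⱼ∂ᵢ + δᵢⱼ·a`. -/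
inductive WeylRel (a : ℂ) (n : ℕ) :
    FreeAlgebra ℂ (Fin n ⊕ Fin n) → FreeAlgebra ℂ (Fin n ⊕ Fin n) → Prop
  | xx (i j : Fin n) : WeylRel a n
      (FreeAlgebra.ι ℂ (Sum.inl i) * FreeAlgebra.ι ℂ (Sum.inl j))
      (FreeAlgebra.ι ℂ (Sum.inl j) * FreeAlgebra.ι ℂ (Sum.inl i))
  | dd (i j : Fin n) : WeylRel a n
      (FreeAlgebra.ι ℂ (Sum.inr i) * FreeAlgebra.ι ℂ (Sum.inr j))
      (FreeAlgebra.ι ℂ (Sum.inr j) * FreeAlgebra.ι ℂ (Sum.inr i))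
  | dx (i j : Fin n) : WeylRel a n
      (FreeAlgebra.ι ℂ (Sum.inr i) * FreeAlgebra.ι ℂ (Sum.inl j))
      (FreeAlgebra.ι ℂ (Sum.inl j) * FreeAlgebra.ι ℂ (Sum.inr i) +
        (if i = j then algebraMap ℂ (FreeAlgebra ℂ (Fin n ⊕ Fin n)) a else 0))

/-- The Weyl algebra `A_n(a)`. -/
def WeylAlg (a : ℂ) (n : ℕ) : Type := RingQuot (WeylRel a n)

instance (a : ℂ) (n : ℕ) : Ring (WeylAlg a n) :=
  inferInstanceAs (Ring (RingQuot (WeylRel a n)))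

instance (a : ℂ) (n : ℕ) : Algebra ℂ (WeylAlg a n) :=
  inferInstanceAs (Algebra ℂ (RingQuot (WeylRel a n)))

/-- The generator `xᵢ` of `A_n(a)`. -/
def wx (a : ℂ) (n : ℕ) (i : Fin n) : WeylAlg a n :=
  RingQuot.mkAlgHom ℂ (WeylRel a n) (FreeAlgebra.ι ℂ (Sum.inl i))

/-- The generator `∂ᵢ` of `A_n(a)`. -/
def wd (a : ℂ) (n : ℕ) (i : Fin n) : WeylAlg a n :=
  RingQuot.mkAlgHom ℂ (WeylRel a n) (FreeAlgebra.ι ℂ (Sum.inr i))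

/-- The element `tᵢ = ∂ᵢxᵢ` of `A_n(a)`. -/
def wt (a : ℂ) (n : ℕ) (i : Fin n) : WeylAlg a n := wd a n i * wx a n i

/-- Evaluation of a polynomial `p ∈ D = ℂ[t₁,…,tₙ]` at the commuting elements
`tᵢ = ∂ᵢxᵢ` of `A_n(a)`; this realizes `D` inside `A_n(a)`. -/
noncomputable def evalT (a : ℂ) (n : ℕ) (p : MvPolynomial (Fin n) ℂ) : WeylAlg a n :=
  p.support.sum fun mo =>
    MvPolynomial.coeff mo p • (((List.finRange n).map fun i => wt a n i ^ mo i).prod)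

/-- The shift `σᵢ` as an algebra endomorphism of `D`: `t_j ↦ t_j − δᵢⱼ·a`. -/
noncomputable def shiftHom (n : ℕ) (a : ℂ) (i : Fin n) :
    MvPolynomial (Fin n) ℂ →ₐ[ℂ] MvPolynomial (Fin n) ℂ :=
  MvPolynomial.aeval (fun j => MvPolynomial.X j - if i = j then MvPolynomial.C a else 0)

/-- The shift automorphism `σᵢ` of `D`: `t_j ↦ t_j − δᵢⱼ·a`. -/
noncomputable def shiftEquiv (n : ℕ) (a : ℂ) (i : Fin n) :
    MvPolynomial (Fin n) ℂ ≃ₐ[ℂ] MvPolynomial (Fin n) ℂ :=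
  AlgEquiv.ofAlgHom (shiftHom n a i) (shiftHom n (-a) i)
    (by
      apply MvPolynomial.algHom_ext
      intro j
      by_cases h : i = j <;>
        simp [shiftHom, h, map_sub, MvPolynomial.aeval_X])
    (by
      apply MvPolynomial.algHom_ext
      intro j
      by_cases h : i = j <;>
        simp [shiftHom, h, map_sub, MvPolynomial.aeval_X])

/-- The group `G` of automorphisms of `D` generated by the shifts `σ₁,…,σₙ`. -/
noncomputable def shiftGroup (n : ℕ) (a : ℂ) :
    Subgroup (MvPolynomial (Fin n) ℂ ≃ₐ[ℂ] MvPolynomial (Fin n) ℂ) :=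
  Subgroup.closure (Set.range (shiftEquiv n a))

namespace WeylAlg

section Relations

variable (a : ℂ) (n : ℕ)

theorem commute_wx_wx (i j : Fin n) : Commute (wx a n i) (wx a n j) := by
  have h := RingQuot.mkAlgHom_rel ℂ (WeylRel.xx (a := a) i j)
  rw [map_mul, map_mul] at h
  exact h

theorem commute_wd_wd (i j : Fin n) : Commute (wd a n i) (wd a n j) := by
  have h := RingQuot.mkAlgHom_rel ℂ (WeylRel.dd (a := a) i j)
  rw [map_mul, map_mul] at h
  exact h

theorem commute_wd_wx {i j : Fin n} (hij : i ≠ j) : Commute (wd a n i) (wx a n j) := by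
  have h := RingQuot.mkAlgHom_rel ℂ (WeylRel.dx (a := a) i j)
  rw [if_neg hij, add_zero, map_mul, map_mul] at h
  exact h

theorem wd_mul_wx (i : Fin n) :
    wd a n i * wx a n i = wx a n i * wd a n i + algebraMap ℂ (WeylAlg a n) a := by
  have h := RingQuot.mkAlgHom_rel ℂ (WeylRel.dx (a := a) i i)
  rw [if_pos rfl, map_add, map_mul, map_mul, AlgHom.commutes] at h
  exact h

theorem wt_mul_wd (i : Fin n) : wt a n i * wd a n i = wd a n i * wt a n i - a • wd a n i := by
  rw [wt, mul_assoc, eq_sub_of_add_eq (wd_mul_wx a n i).symm, mul_sub, ← Algebra.commutes,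
    ← Algebra.smul_def]

theorem wt_mul_wx (i : Fin n) : wt a n i * wx a n i = wx a n i * wt a n i + a • wx a n i := by
  rw [wt, wd_mul_wx, add_mul, mul_assoc, ← Algebra.smul_def, ← wd_mul_wx]

/-- A property of elements of the Weyl algebra that holds for scalars and the generators and is
stable under sums and products holds everywhere. -/
theorem induction {motive : WeylAlg a n → Prop}
    (scalar : ∀ c : ℂ, motive (algebraMap ℂ (WeylAlg a n) c))
    (x : ∀ i, motive (wx a n i)) (d : ∀ i, motive (wd a n i))
    (mul : ∀ u v, motive u → motive v → motive (u * v))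
    (add : ∀ u v, motive u → motive v → motive (u + v)) (u : WeylAlg a n) : motive u := by
  obtain ⟨f, rfl⟩ := RingQuot.mkAlgHom_surjective ℂ (WeylRel a n) u
  induction f using FreeAlgebra.induction with
  | grade0 c => rw [AlgHom.commutes]; exact scalar c
  | grade1 s =>
    rcases s with i | i
    · exact x i
    · exact d i
  | mul f g hf hg => rw [map_mul]; exact mul _ _ hf hg
  | add f g hf hg => rw [map_add]; exact add _ _ hf hg

/-- The monomial of degree `k` in the variables `xᵢ`, `∂ᵢ`: it is `∂ᵢ ^ k` if `k ≥ 0` and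
`xᵢ ^ (-k)` if `k ≤ 0`. -/
def ladder (i : Fin n) (k : ℤ) : WeylAlg a n := wd a n i ^ k.toNat * wx a n i ^ (-k).toNat

@[simp]
theorem ladder_natCast (i : Fin n) (k : ℕ) : ladder a n i k = wd a n i ^ k := by
  simp [ladder]

@[simp]
theorem ladder_neg_natCast (i : Fin n) (k : ℕ) : ladder a n i (-k) = wx a n i ^ k := by
  simp [ladder]

variable {n} in
theorem commute_ladder_of_commute {i : Fin n} {u : WeylAlg a n} (hd : Commute u (wd a n i))
    (hx : Commute u (wx a n i)) (k : ℤ) : Commute u (ladder a n i k) :=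
  (hd.pow_right _).mul_right (hx.pow_right _)

variable {n} in
theorem commute_wx_ladder {i j : Fin n} (hij : i ≠ j) (k : ℤ) :
    Commute (wx a n i) (ladder a n j k) :=
  commute_ladder_of_commute a (commute_wd_wx a n hij.symm).symm (commute_wx_wx a n i j) k

variable {n} in
theorem commute_wd_ladder {i j : Fin n} (hij : i ≠ j) (k : ℤ) :
    Commute (wd a n i) (ladder a n j k) :=
  commute_ladder_of_commute a (commute_wd_wd a n i j) (commute_wd_wx a n hij) k

variable {n} in
theorem commute_ladder_ladder {i j : Fin n} (hij : i ≠ j) (k l : ℤ) :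
    Commute (ladder a n i k) (ladder a n j l) :=
  commute_ladder_of_commute a (commute_wd_ladder a hij.symm k).symm
    (commute_wx_ladder a hij.symm k).symm l

/-- The product (in any order) of the monomials `ladder a n i (k i)`, `i ∈ s`. -/
def monomial (k : Fin n → ℤ) (s : Finset (Fin n)) : WeylAlg a n :=
  s.noncommProd (fun i => ladder a n i (k i)) fun _ _ _ _ hij => commute_ladder_ladder a hij _ _

variable {n}

theorem monomial_insert (k : Fin n → ℤ) {s : Finset (Fin n)} {i : Fin n} (hi : i ∉ s) :
    monomial a n k (insert i s) = ladder a n i (k i) * monomial a n k s :=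
  Finset.noncommProd_insert_of_notMem _ _ _ _ hi

theorem monomial_congr {k l : Fin n → ℤ} {s : Finset (Fin n)} (h : ∀ i ∈ s, k i = l i) :
    monomial a n k s = monomial a n l s :=
  Finset.noncommProd_congr rfl (fun i hi => by rw [h i hi]) _

theorem commute_wx_monomial (k : Fin n → ℤ) {s : Finset (Fin n)} {i : Fin n} (hi : i ∉ s) :
    Commute (wx a n i) (monomial a n k s) :=
  Finset.noncommProd_commute _ _ _ _ fun _ hj =>
    commute_wx_ladder a (ne_of_mem_of_not_mem hj hi).symm _

theorem commute_wt_monomial (k : Fin n → ℤ) {s : Finset (Fin n)} {i : Fin n} (hi : i ∉ s) :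
    Commute (wt a n i) (monomial a n k s) :=
  Commute.mul_left (Finset.noncommProd_commute _ _ _ _ fun _ hj =>
    commute_wd_ladder a (ne_of_mem_of_not_mem hj hi).symm _) (commute_wx_monomial a k hi)

end Relations

section Modules

variable {a : ℂ} {n : ℕ} {V : Type*} [AddCommGroup V] [Module ℂ V] [Module (WeylAlg a n) V]
  [IsScalarTower ℂ (WeylAlg a n) V]

theorem wt_smul_wd_smul {i : Fin n} {μ : ℂ} {w : V} (hw : wt a n i • w = μ • w) :
    wt a n i • wd a n i • w = (μ - a) • wd a n i • w := by
  rw [smul_smul, wt_mul_wd, sub_smul, mul_smul, hw, smul_comm, smul_assoc, sub_smul]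

theorem wt_smul_wx_smul {i : Fin n} {μ : ℂ} {w : V} (hw : wt a n i • w = μ • w) :
    wt a n i • wx a n i • w = (μ + a) • wx a n i • w := by
  rw [smul_smul, wt_mul_wx, add_smul, mul_smul, hw, smul_comm, smul_assoc, add_smul]

theorem wx_smul_wd_smul {i : Fin n} {μ : ℂ} {w : V} (hw : wt a n i • w = μ • w) :
    wx a n i • wd a n i • w = (μ - a) • w := by
  rw [smul_smul, eq_sub_of_add_eq (wd_mul_wx a n i).symm, sub_smul, ← wt, hw, sub_smul,
    algebraMap_smul]

theorem wt_smul_wd_pow_smul {i : Fin n} {μ : ℂ} {w : V} (hw : wt a n i • w = μ • w) (k : ℕ) :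
    wt a n i • wd a n i ^ k • w = (μ - k * a) • wd a n i ^ k • w := by
  induction k with
  | zero => simpa using hw
  | succ k ih =>
    rw [pow_succ', mul_smul, wt_smul_wd_smul ih]
    congr 1
    push_cast
    ring

theorem wt_smul_wx_pow_smul {i : Fin n} {μ : ℂ} {w : V} (hw : wt a n i • w = μ • w) (k : ℕ) :
    wt a n i • wx a n i ^ k • w = (μ + k * a) • wx a n i ^ k • w := by
  induction k with
  | zero => simpa using hw
  | succ k ih =>
    rw [pow_succ', mul_smul, wt_smul_wx_smul ih]
    congr 1
    push_cast
    ring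

theorem wt_smul_ladder_smul {i : Fin n} {μ : ℂ} {w : V} (hw : wt a n i • w = μ • w) (k : ℤ) :
    wt a n i • ladder a n i k • w = (μ - k * a) • ladder a n i k • w := by
  obtain ⟨m, rfl | rfl⟩ := k.eq_nat_or_neg
  · simpa using wt_smul_wd_pow_smul hw m
  · simpa using wt_smul_wx_pow_smul hw m

theorem wd_smul_ladder_smul {i : Fin n} {μ : ℂ} {w : V} (hw : wt a n i • w = μ • w) (k : ℤ) :
    ∃ c : ℂ, wd a n i • ladder a n i k • w = c • ladder a n i (k + 1) • w := by
  obtain ⟨m, rfl | rfl⟩ := k.eq_nat_or_neg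
  · refine ⟨1, ?_⟩
    rw [← Nat.cast_succ, ladder_natCast, ladder_natCast, smul_smul, ← pow_succ', one_smul]
  · rcases m with _ | m
    · exact ⟨1, by simp [ladder]⟩
    · refine ⟨μ + m * a, ?_⟩
      rw [show -((m + 1 : ℕ) : ℤ) + 1 = -(m : ℤ) by push_cast; ring, ladder_neg_natCast,
        ladder_neg_natCast, pow_succ', mul_smul, ← mul_smul (wd a n i), ← wt,
        wt_smul_wx_pow_smul hw]

theorem wx_smul_ladder_smul {i : Fin n} {μ : ℂ} {w : V} (hw : wt a n i • w = μ • w) (k : ℤ) :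
    ∃ c : ℂ, wx a n i • ladder a n i k • w = c • ladder a n i (k - 1) • w := by
  obtain ⟨m, rfl | rfl⟩ := k.eq_nat_or_neg
  · rcases m with _ | m
    · exact ⟨1, by simp [ladder]⟩
    · refine ⟨μ - m * a - a, ?_⟩
      rw [show ((m + 1 : ℕ) : ℤ) - 1 = (m : ℤ) by push_cast; ring, ladder_natCast,
        ladder_natCast, pow_succ', mul_smul, wx_smul_wd_smul (wt_smul_wd_pow_smul hw m)]
  · refine ⟨1, ?_⟩
    rw [show -(m : ℤ) - 1 = -((m + 1 : ℕ) : ℤ) by push_cast; ring, ladder_neg_natCast,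
      ladder_neg_natCast, smul_smul, ← pow_succ', one_smul]

theorem exists_smul_wd_pow_smul {i : Fin n} {μ : ℂ} {w : V} (hw : wt a n i • w = μ • w) (k : ℕ)
    (h : ∀ l : ℕ, μ - (l + 1) * a ≠ 0) : ∃ z : WeylAlg a n, z • wd a n i ^ k • w = w := by
  induction k with
  | zero => exact ⟨1, by simp⟩
  | succ k ih =>
    obtain ⟨z, hz⟩ := ih
    refine ⟨z * (μ - (k + 1) * a)⁻¹ • wx a n i, ?_⟩
    rw [pow_succ', mul_smul, mul_smul, smul_assoc, wx_smul_wd_smul (wt_smul_wd_pow_smul hw k),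
      sub_sub, ← add_one_mul, inv_smul_smul₀ (h k), hz]

theorem exists_smul_wx_pow_smul {i : Fin n} {μ : ℂ} {w : V} (hw : wt a n i • w = μ • w) (k : ℕ)
    (h : ∀ l : ℕ, μ + l * a ≠ 0) : ∃ z : WeylAlg a n, z • wx a n i ^ k • w = w := by
  induction k with
  | zero => exact ⟨1, by simp⟩
  | succ k ih =>
    obtain ⟨z, hz⟩ := ih
    refine ⟨z * (μ + k * a)⁻¹ • wd a n i, ?_⟩
    rw [pow_succ', mul_smul, mul_smul, smul_assoc, ← mul_smul (wd a n i), ← wt,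
      wt_smul_wx_pow_smul hw, inv_smul_smul₀ (h k), hz]

/-- If a submodule contains a sum of joint eigenvectors of the `tᵢ` with pairwise distinct
weights, then it contains every summand. -/
theorem mem_of_sum_weight_mem {ι : Type*} (N : Submodule (WeylAlg a n) V) (χ : ι → Fin n → ℂ)
    (hχ : Function.Injective χ) (s : Finset ι) (u : ι → V)
    (hu : ∀ k ∈ s, ∀ i, wt a n i • u k = χ k i • u k) (hs : ∑ k ∈ s, u k ∈ N) :
    ∀ k ∈ s, u k ∈ N := by
  classical
  induction s using Finset.induction_on generalizing u with
  | empty => simp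
  | insert k₀ s hk₀ ih =>
    have key : ∀ k ∈ s, u k ∈ N := by
      intro k hk
      obtain ⟨i, hi⟩ := Function.ne_iff.1 (hχ.ne (ne_of_mem_of_not_mem hk hk₀))
      have hmem : ∑ l ∈ s, (χ l i - χ k₀ i) • u l ∈ N := by
        have h := N.sub_mem (N.smul_mem (wt a n i) hs) (N.smul_of_tower_mem (χ k₀ i) hs)
        rw [Finset.smul_sum, Finset.smul_sum, ← Finset.sum_sub_distrib,
          Finset.sum_insert hk₀, hu k₀ (Finset.mem_insert_self _ _), sub_self, zero_add] at h
        rwa [Finset.sum_congr rfl fun l hl => by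
          rw [sub_smul, ← hu l (Finset.mem_insert_of_mem hl)]]
      have h := ih (fun l => (χ l i - χ k₀ i) • u l) (fun l hl j => by
        rw [smul_comm, hu l (Finset.mem_insert_of_mem hl), smul_comm]) hmem k hk
      have h' := N.smul_of_tower_mem (χ k i - χ k₀ i)⁻¹ h
      rwa [inv_smul_smul₀ (sub_ne_zero.2 hi)] at h'
    intro k hk
    rcases Finset.mem_insert.1 hk with rfl | hk
    · rw [Finset.sum_insert hk₀] at hs
      exact (N.add_mem_iff_left (N.sum_mem key)).1 hs
    · exact key k hk

theorem exists_smul_ladder_smul (ha : a ≠ 0) {i : Fin n} {μ : ℂ} {w : V}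
    (hw : wt a n i • w = μ • w) (k : ℤ) (h : μ = 0 ∧ 0 ≤ k ∨ ∀ z : ℤ, μ ≠ z * a) :
    ∃ z : WeylAlg a n, z • ladder a n i k • w = w := by
  have hpos (h' : μ = 0 ∨ ∀ z : ℤ, μ ≠ z * a) (m : ℕ) :
      ∃ z : WeylAlg a n, z • ladder a n i m • w = w := by
    rw [ladder_natCast]
    refine exists_smul_wd_pow_smul hw m fun l => ?_
    rcases h' with rfl | h'
    · rw [zero_sub, neg_ne_zero]
      exact mul_ne_zero l.cast_add_one_ne_zero ha
    · exact sub_ne_zero.2 (by simpa using h' (l + 1))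
  rcases h with ⟨hμ, hk⟩ | h
  · lift k to ℕ using hk
    exact hpos (.inl hμ) k
  · obtain ⟨m, rfl | rfl⟩ := k.eq_nat_or_neg
    · exact hpos (.inr h) m
    · rw [ladder_neg_natCast]
      refine exists_smul_wx_pow_smul hw m fun l hl => h (-l) ?_
      push_cast
      linear_combination hl

section WeightVector

variable {v : V} {wgt : Fin n → ℂ} (hv : ∀ i, wt a n i • v = wgt i • v)

include hv

theorem wt_smul_monomial_smul (k : Fin n → ℤ) {s : Finset (Fin n)} {i : Fin n} (hi : i ∉ s) :
    wt a n i • monomial a n k s • v = wgt i • monomial a n k s • v := by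
  rw [smul_smul, (commute_wt_monomial a k hi).eq, mul_smul, hv, smul_comm]

/-- Splitting off the `i`-th factor of all monomial vectors that agree outside `i`. -/
theorem exists_ladder_smul_eq (k : Fin n → ℤ) (i : Fin n) :
    ∃ w : V, wt a n i • w = wgt i • w ∧ (wx a n i • v = 0 → wx a n i • w = 0) ∧
      ∀ l, monomial a n (Function.update k i l) Finset.univ • v = ladder a n i l • w := by
  have hi : i ∉ Finset.univ.erase i := Finset.notMem_erase i _
  refine ⟨monomial a n k (Finset.univ.erase i) • v, wt_smul_monomial_smul hv k hi, fun h => ?_,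
    fun l => ?_⟩
  · rw [smul_smul, (commute_wx_monomial a k hi).eq, mul_smul, h, smul_zero]
  · rw [← Finset.insert_erase (Finset.mem_univ i), monomial_insert a _ hi, mul_smul,
      Function.update_self, Finset.insert_erase (Finset.mem_univ i)]
    rw [monomial_congr a fun j hj => Function.update_of_ne (Finset.ne_of_mem_erase hj) _ _]

theorem wt_smul_monomial_univ_smul (k : Fin n → ℤ) (i : Fin n) :
    wt a n i • monomial a n k Finset.univ • v =
      (wgt i - k i * a) • monomial a n k Finset.univ • v := by
  obtain ⟨w, hw, -, hl⟩ := exists_ladder_smul_eq hv k i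
  have h := hl (k i)
  rw [Function.update_eq_self] at h
  rw [h, wt_smul_ladder_smul hw]

theorem smul_mem_span_monomial (u : WeylAlg a n) :
    u • v ∈ Submodule.span ℂ (Set.range fun k => monomial a n k Finset.univ • v) := by
  set U := Submodule.span ℂ (Set.range fun k => monomial a n k Finset.univ • v) with hU
  have stable (g : WeylAlg a n) (h : ∀ k, g • monomial a n k Finset.univ • v ∈ U) :
      ∀ x ∈ U, g • x ∈ U := by
    intro x hx
    induction hx using Submodule.span_induction with
    | mem x hx =>
      obtain ⟨k, rfl⟩ := hx
      exact h k
    | zero => rw [smul_zero]; exact U.zero_mem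
    | add x y _ _ hx hy => rw [smul_add]; exact U.add_mem hx hy
    | smul c x _ hx => rw [smul_comm]; exact U.smul_mem c hx
  have main : ∀ x ∈ U, u • x ∈ U := by
    induction u using WeylAlg.induction with
    | scalar c => intro x hx; rw [algebraMap_smul]; exact U.smul_mem c hx
    | x i =>
      refine stable _ fun k => ?_
      obtain ⟨w, hw, -, hl⟩ := exists_ladder_smul_eq hv k i
      obtain ⟨c, hc⟩ := wx_smul_ladder_smul hw (k i)
      rw [← Function.update_eq_self i k, hl, hc, ← hl]
      exact U.smul_mem c (Submodule.subset_span ⟨_, rfl⟩)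
    | d i =>
      refine stable _ fun k => ?_
      obtain ⟨w, hw, -, hl⟩ := exists_ladder_smul_eq hv k i
      obtain ⟨c, hc⟩ := wd_smul_ladder_smul hw (k i)
      rw [← Function.update_eq_self i k, hl, hc, ← hl]
      exact U.smul_mem c (Submodule.subset_span ⟨_, rfl⟩)
    | mul u u' hu hu' => intro x hx; rw [mul_smul]; exact hu _ (hu' x hx)
    | add u u' hu hu' => intro x hx; rw [add_smul]; exact U.add_mem (hu x hx) (hu' x hx)
  refine main v (Submodule.subset_span ⟨0, ?_⟩)
  have : monomial a n 0 Finset.univ = 1 :=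
    Finset.noncommProd_induction _ _ _ (· = 1) (fun x y hx hy => by rw [hx, hy, one_mul]) rfl
      fun i _ => by simp [ladder]
  simp only [this, one_smul]

theorem exists_smul_monomial_smul (ha : a ≠ 0) (k : Fin n → ℤ)
    (hk : ∀ i, wgt i = 0 ∧ 0 ≤ k i ∨ ∀ z : ℤ, wgt i ≠ z * a) (s : Finset (Fin n)) :
    ∃ z : WeylAlg a n, z • monomial a n k s • v = v := by
  induction s using Finset.induction_on with
  | empty => exact ⟨1, (one_smul _ _).trans (one_smul _ v)⟩
  | insert i s hi ih =>
    obtain ⟨z, hz⟩ := ih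
    obtain ⟨y, hy⟩ := exists_smul_ladder_smul ha (wt_smul_monomial_smul hv k hi) (k i) (hk i)
    exact ⟨z * y, by rw [monomial_insert a k hi, mul_smul, mul_smul, hy, hz]⟩

/-- If each weight of the cyclic vector `v` is either `0`, with `v` killed by `xᵢ`, or not an
integral multiple of `a`, then the module generated by `v` is simple. -/
theorem isSimpleModule_of_weight_vector (ha : a ≠ 0) (hv₀ : v ≠ 0)
    (hspan : ∀ w : V, ∃ u : WeylAlg a n, u • v = w)
    (hwgt : ∀ i, (wgt i = 0 ∧ wx a n i • v = 0) ∨ ∀ z : ℤ, wgt i ≠ z * a) :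
    IsSimpleModule (WeylAlg a n) V := by
  rw [isSimpleModule_iff_toSpanSingleton_surjective]
  refine ⟨⟨v, 0, hv₀⟩, fun w hw => ?_⟩
  rw [← LinearMap.range_eq_top]
  set N := LinearMap.range (LinearMap.toSpanSingleton (WeylAlg a n) V w)
  have hwN : w ∈ N := ⟨1, by simp⟩
  suffices hvN : v ∈ N by
    refine eq_top_iff.2 fun x _ => ?_
    obtain ⟨u, rfl⟩ := hspan x
    exact N.smul_mem u hvN
  obtain ⟨u, rfl⟩ := hspan w
  obtain ⟨c, hc⟩ := Finsupp.mem_span_range_iff_exists_finsupp.1 (smul_mem_span_monomial hv u)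
  have hmem := mem_of_sum_weight_mem N (fun (k : Fin n → ℤ) i => wgt i - k i * a)
    (fun k l h => funext fun i => by simpa [ha] using congrFun h i) c.support
    (fun k => c k • monomial a n k Finset.univ • v)
    (fun k _ i => by rw [smul_comm, wt_smul_monomial_univ_smul hv, smul_comm])
    (by rw [← hc] at hwN; exact hwN)
  obtain ⟨k, hk, hk₀⟩ : ∃ k ∈ c.support, c k • monomial a n k Finset.univ • v ≠ 0 :=
    Finset.exists_ne_zero_of_sum_ne_zero (by rw [← hc] at hw; exact hw)
  have hkN : monomial a n k Finset.univ • v ∈ N := by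
    have h := N.smul_of_tower_mem (c k)⁻¹ (hmem k hk)
    rwa [inv_smul_smul₀ (Finsupp.mem_support_iff.1 hk)] at h
  obtain ⟨z, hz⟩ := exists_smul_monomial_smul hv ha k (fun i => by
    refine (hwgt i).imp (fun hi => ⟨hi.1, ?_⟩) id
    by_contra! hneg
    obtain ⟨m, hm⟩ := Int.eq_ofNat_of_zero_le (Int.le_sub_one_of_lt (Int.neg_pos_of_neg hneg))
    obtain ⟨x, -, hx, hl⟩ := exists_ladder_smul_eq hv k i
    have h := hl (k i)
    rw [Function.update_eq_self, show k i = -((m + 1 : ℕ) : ℤ) by push_cast; omega,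
      ladder_neg_natCast, pow_succ, mul_smul, hx hi.2, smul_zero] at h
    exact hk₀ (by rw [h, smul_zero])) Finset.univ
  rw [← hz]
  exact N.smul_mem z hkN

theorem evalT_smul (p : MvPolynomial (Fin n) ℂ) :
    evalT a n p • v = MvPolynomial.aeval wgt p • v := by
  have hpow (i : Fin n) (m : ℕ) : wt a n i ^ m • v = wgt i ^ m • v := by
    induction m with
    | zero => simp
    | succ m ih => rw [pow_succ', mul_smul, ih, smul_comm, hv, smul_smul, pow_succ]
  have hlist (l : List (Fin n)) (mo : Fin n →₀ ℕ) :
      (l.map fun i => wt a n i ^ mo i).prod • v = (l.map fun i => wgt i ^ mo i).prod • v := by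
    induction l with
    | nil => simp
    | cons i l ih =>
      rw [List.map_cons, List.prod_cons, mul_smul, ih, smul_comm, hpow, smul_smul, List.map_cons,
        List.prod_cons, mul_comm]
  rw [evalT, Finset.sum_smul, MvPolynomial.aeval_def, MvPolynomial.eval₂_eq', Finset.sum_smul]
  refine Finset.sum_congr rfl fun mo _ => ?_
  rw [smul_assoc, hlist, smul_smul, Fin.prod_univ_def, Algebra.algebraMap_self_apply]

end WeightVector

end Modules

section EvalT

variable (a : ℂ) (n : ℕ)

theorem evalT_X_sub_C (i : Fin n) (c : ℂ) :
    evalT a n (MvPolynomial.X i - MvPolynomial.C c) = wt a n i - algebraMap ℂ _ c := by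
  have hlin (p : MvPolynomial (Fin n) ℂ) : evalT a n p =
      (MvPolynomial.basisMonomials (Fin n) ℂ).constr ℂ
        (fun mo => ((List.finRange n).map fun j => wt a n j ^ mo j).prod) p := by
    rw [Module.Basis.constr_apply]
    rfl
  have hX : MvPolynomial.X i = MvPolynomial.basisMonomials (Fin n) ℂ (Finsupp.single i 1) := by
    simp [MvPolynomial.X]
  have hC : MvPolynomial.C c = c • MvPolynomial.basisMonomials (Fin n) ℂ 0 := by
    rw [MvPolynomial.coe_basisMonomials, MvPolynomial.smul_monomial, smul_eq_mul, mul_one,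
      MvPolynomial.C_apply]
  have hlist (l : List (Fin n)) (hl : l.Nodup) :
      (l.map fun j => wt a n j ^ (Finsupp.single i 1 : Fin n →₀ ℕ) j).prod =
        if i ∈ l then wt a n i else 1 := by
    induction l with
    | nil => simp
    | cons j l ih =>
      obtain ⟨hj, hl⟩ := List.nodup_cons.1 hl
      rw [List.map_cons, List.prod_cons, ih hl]
      rcases eq_or_ne i j with rfl | hij
      · simp [hj]
      · simp [hij]
  rw [hlin, map_sub, hX, hC, map_smul, Module.Basis.constr_basis, Module.Basis.constr_basis,
    hlist _ (List.nodup_finRange n), if_pos (List.mem_finRange i), Algebra.algebraMap_eq_smul_one]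
  simp

end EvalT

section Model

variable (a : ℂ) {n : ℕ} (wgt : Fin n → ℂ)

/-- The action of `∂ᵢ` on functions on the weight lattice. -/
def modelD (i : Fin n) : Module.End ℂ ((Fin n → ℤ) → ℂ) where
  toFun f k := f (k - Pi.single i 1)
  map_add' _ _ := rfl
  map_smul' _ _ := rfl

/-- The action of `xᵢ` on functions on the weight lattice. -/
noncomputable def modelX (i : Fin n) : Module.End ℂ ((Fin n → ℤ) → ℂ) where
  toFun f k := (wgt i - (k i + 1) * a) * f (k + Pi.single i 1)
  map_add' _ _ := by ext; simp [mul_add]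
  map_smul' _ _ := by ext; simp; ring

/-- The representation of the Weyl algebra on functions on the weight lattice. -/
theorem exists_model : ∃ ρ : WeylAlg a n →ₐ[ℂ] Module.End ℂ ((Fin n → ℤ) → ℂ),
    (∀ i, ρ (wx a n i) = modelX a wgt i) ∧ ∀ i, ρ (wd a n i) = modelD i := by
  let F : FreeAlgebra ℂ (Fin n ⊕ Fin n) →ₐ[ℂ] Module.End ℂ ((Fin n → ℤ) → ℂ) :=
    FreeAlgebra.lift ℂ (Sum.elim (modelX a wgt) modelD)
  have hF : ∀ ⦃u w⦄, WeylRel a n u w → F u = F w := by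
    intro u w h
    rcases h with ⟨i, j⟩ | ⟨i, j⟩ | ⟨i, j⟩
    · rcases eq_or_ne i j with rfl | hij
      · rfl
      refine LinearMap.ext fun f => funext fun k => ?_
      simp [F, modelX, hij, hij.symm, add_right_comm]
      ring
    · refine LinearMap.ext fun f => funext fun k => ?_
      simp [F, modelD, sub_right_comm]
    · refine LinearMap.ext fun f => funext fun k => ?_
      rcases eq_or_ne i j with rfl | hij
      · simp [F, modelX, modelD, Module.algebraMap_end_apply]
        ring
      · simp [F, modelX, modelD, hij, hij.symm, sub_add_eq_add_sub]
  refine ⟨RingQuot.liftAlgHom ℂ ⟨F, hF⟩, fun i => ?_, fun i => ?_⟩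
  · refine (RingQuot.liftAlgHom_mkAlgHom_apply ℂ F hF _).trans ?_
    simp [F]
  · refine (RingQuot.liftAlgHom_mkAlgHom_apply ℂ F hF _).trans ?_
    simp [F]

theorem one_notMem_span (S : Set (MvPolynomial (Fin n) ℂ)) (I : Set (Fin n))
    (hS : ∀ p ∈ S, MvPolynomial.aeval wgt p = 0) (hI : ∀ i ∈ I, wgt i = 0) :
    (1 : WeylAlg a n) ∉ Submodule.span (WeylAlg a n) (evalT a n '' S ∪ wx a n '' I) := by
  obtain ⟨ρ, hx, hd⟩ := exists_model a wgt
  let _ : Module (WeylAlg a n) ((Fin n → ℤ) → ℂ) := Module.compHom _ ρ.toRingHom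
  have hρ (u : WeylAlg a n) (f : (Fin n → ℤ) → ℂ) : u • f = ρ u f := rfl
  have : IsScalarTower ℂ (WeylAlg a n) ((Fin n → ℤ) → ℂ) :=
    ⟨fun c u f => by rw [hρ, hρ, map_smul, LinearMap.smul_apply]⟩
  let e : (Fin n → ℤ) → ℂ := Pi.single 0 1
  have he : ∀ i, wt a n i • e = wgt i • e := by
    intro i
    rw [hρ, wt, map_mul, hx, hd]
    ext k
    rcases eq_or_ne k 0 with rfl | hk
    · simp [e, modelX, modelD]
    · simp [e, modelX, modelD, hk]
  have hker : Submodule.span (WeylAlg a n) (evalT a n '' S ∪ wx a n '' I) ≤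
      LinearMap.ker (LinearMap.toSpanSingleton (WeylAlg a n) _ e) := by
    rw [Submodule.span_le]
    rintro _ (⟨p, hp, rfl⟩ | ⟨i, hi, rfl⟩)
    · rw [SetLike.mem_coe, LinearMap.mem_ker, LinearMap.toSpanSingleton_apply, evalT_smul he,
        hS p hp, zero_smul]
    · rw [SetLike.mem_coe, LinearMap.mem_ker, LinearMap.toSpanSingleton_apply, hρ, hx]
      ext k
      rcases eq_or_ne (k + Pi.single i 1) 0 with hk | hk
      · have hki : k i + 1 = 0 := by simpa using congrFun hk i
        have hkc : (k i : ℂ) + 1 = 0 := by exact_mod_cast hki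
        simp [modelX, hI i hi, hkc]
      · simp [e, modelX, hk]
  intro h1
  have h := hker h1
  rw [LinearMap.mem_ker, LinearMap.toSpanSingleton_apply, one_smul] at h
  simpa [e] using congrFun h 0

end Model

theorem shiftEquiv_zpow_X (n : ℕ) (a : ℂ) (i : Fin n) (z : ℤ) :
    (shiftEquiv n a i ^ z) (MvPolynomial.X i) = MvPolynomial.X i - MvPolynomial.C (z * a) := by
  have h1 : shiftEquiv n a i (MvPolynomial.X i) = MvPolynomial.X i - MvPolynomial.C a := by
    simp [shiftEquiv, shiftHom]
  have hC (τ : MvPolynomial (Fin n) ℂ ≃ₐ[ℂ] MvPolynomial (Fin n) ℂ) (c : ℂ) :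
      τ (MvPolynomial.C c) = MvPolynomial.C c := τ.commutes c
  have h2 : (shiftEquiv n a i)⁻¹ (MvPolynomial.X i) = MvPolynomial.X i + MvPolynomial.C a := by
    rw [AlgEquiv.aut_inv, AlgEquiv.symm_apply_eq, map_add, hC, h1, sub_add_cancel]
  induction z using Int.induction_on with
  | zero => simp
  | succ m ih =>
    rw [zpow_add_one, AlgEquiv.mul_apply, h1, map_sub, ih, hC, sub_sub, ← map_add]
    congr 2
    push_cast
    ring
  | pred m ih =>
    rw [zpow_sub_one, AlgEquiv.mul_apply, h2, map_add, ih, hC, sub_add, ← map_sub]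
    congr 2
    push_cast
    ring

end WeylAlg

theorem stmt_14 (a : ℂ) (ha : a ≠ 0) (n : ℕ) (I : Set (Fin n))
    (m : Ideal (MvPolynomial (Fin n) ℂ)) (hm : m.IsMaximal)
    (hbrk : ∀ i ∈ I, MvPolynomial.X i ∈ m)
    (hnd : ∀ j : Fin n, j ∉ I → ∀ τ ∈ shiftGroup n a,
      MvPolynomial.X j ∉ m.map (τ : MvPolynomial (Fin n) ℂ ≃ₐ[ℂ] MvPolynomial (Fin n) ℂ).toAlgHom) :
    IsSimpleModule (WeylAlg a n)
      (WeylAlg a n ⧸ Submodule.span (WeylAlg a n)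
        ((evalT a n '' (m : Set (MvPolynomial (Fin n) ℂ))) ∪ (wx a n '' I))) := by
  obtain ⟨wgt, hwgt⟩ := MvPolynomial.isMaximal_iff_eq_vanishingIdeal_singleton.1 hm
  have hmem (p : MvPolynomial (Fin n) ℂ) : p ∈ m ↔ MvPolynomial.aeval wgt p = 0 := by
    rw [hwgt, MvPolynomial.mem_vanishingIdeal_singleton_iff]
  have hI : ∀ i ∈ I, wgt i = 0 := fun i hi => by simpa using (hmem _).1 (hbrk i hi)
  have hJ : ∀ j ∉ I, ∀ z : ℤ, wgt j ≠ z * a := by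
    intro j hj z hz
    refine hnd j hj (shiftEquiv n a j ^ (-z))
      (zpow_mem (Subgroup.subset_closure (Set.mem_range_self j)) _) ?_
    have h : MvPolynomial.X j - MvPolynomial.C (z * a) ∈ m := by simp [hmem, hz]
    have h' := Ideal.mem_map_of_mem (shiftEquiv n a j ^ (-z)).toAlgHom h
    have heq : (shiftEquiv n a j ^ (-z)).toAlgHom (MvPolynomial.X j - MvPolynomial.C (z * a)) =
        MvPolynomial.X j := by
      rw [map_sub]
      refine (congrArg₂ _ (WeylAlg.shiftEquiv_zpow_X n a j (-z))
        ((shiftEquiv n a j ^ (-z)).commutes (z * a))).trans ?_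
      simp [MvPolynomial.algebraMap_eq]
    rwa [heq] at h'
  set J := Submodule.span (WeylAlg a n)
    ((evalT a n '' (m : Set (MvPolynomial (Fin n) ℂ))) ∪ (wx a n '' I)) with hJdef
  refine WeylAlg.isSimpleModule_of_weight_vector (v := J.mkQ 1) (wgt := wgt) (fun i => ?_) ha ?_
    (fun w => ?_) fun i => ?_
  · rw [← map_smul, ← LinearMap.map_smul_of_tower, ← sub_eq_zero, ← map_sub, Submodule.mkQ_apply,
      Submodule.Quotient.mk_eq_zero, smul_eq_mul, mul_one, ← Algebra.algebraMap_eq_smul_one,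
      ← WeylAlg.evalT_X_sub_C]
    exact Submodule.subset_span (.inl ⟨_, (hmem _).2 (by simp), rfl⟩)
  · rw [Submodule.mkQ_apply, Ne, Submodule.Quotient.mk_eq_zero]
    exact WeylAlg.one_notMem_span a wgt _ I (fun p hp => (hmem p).1 hp) hI
  · obtain ⟨u, rfl⟩ := J.mkQ_surjective w
    exact ⟨u, by rw [← map_smul, smul_eq_mul, mul_one]⟩
  · by_cases hi : i ∈ I
    · refine .inl ⟨hI i hi, ?_⟩
      rw [← map_smul, smul_eq_mul, mul_one, Submodule.mkQ_apply, Submodule.Quotient.mk_eq_zero]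
      exact Submodule.subset_span (.inr ⟨i, hi, rfl⟩)
    · exact .inr (hJ i hi)
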